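/- Under the hypotheses of the quantitative asymptotic regularity theorem (uniformly convex hyperbolic space with monotone modulus η, C nonempty convex, T : C → C asymptotically nonexpansive with sequence (k_n), Σ_{n=0}^∞ k_n ≤ K, 1/L ≤ λ_n ≤ 1 − 1/L for all n with L ∈ ℕ, L ≥ 2, and x ∈ C, b > 0 such that for every δ > 0 there is p ∈ C with d(x,p) ≤ b and d(Tp,p) ≤ δ), assume moreover that η(r,ε) can be written as η(r,ε) = ε·η̃(r,ε) where η̃ is nondecreasing in ε for each fixed r. Then for all ε ∈ (0,1] and all g : ℕ → ℕ there exists N ≤ Φ such that d(x_m, T x_m) < ε for all m ∈ [N, N + g(N)], where Φ := h^M(0) with h(n) := g(n+1) + n + 2, M := ⌈3(5KD + D + 11/2)/θ⌉, D := e^K·(b + 2), θ := (ε/(L²·f(K)))·η̃((1+K)D + 1, ε/(f(K)·((1+K)D + 1))), and f(K) := 2(1 + (1+K)²(2+K)). -/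

import Mathlib

open Filter Set

section Hyperbolic

variable {X : Type*}

/-- A hyperbolic space structure: `W x y t` represents `(1-t)x ⊕ t y`. -/
structure IsWMap [MetricSpace X] (W : X → X → ℝ → X) : Prop where
  w1 : ∀ (x y z : X), ∀ t ∈ Set.Icc (0:ℝ) 1,
    dist z (W x y t) ≤ (1 - t) * dist z x + t * dist z y
  w2 : ∀ (x y : X), ∀ t ∈ Set.Icc (0:ℝ) 1, ∀ s ∈ Set.Icc (0:ℝ) 1,
    dist (W x y t) (W x y s) = |t - s| * dist x y
  w3 : ∀ (x y : X), ∀ t ∈ Set.Icc (0:ℝ) 1, W x y t = W y x (1 - t)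
  w4 : ∀ (x y z w : X), ∀ t ∈ Set.Icc (0:ℝ) 1,
    dist (W x z t) (W y w t) ≤ (1 - t) * dist x y + t * dist z w

/-- `η` is a modulus of uniform convexity for the hyperbolic space `(X, dist, W)`. -/
def IsUCModulus [MetricSpace X] (W : X → X → ℝ → X) (η : ℝ → ℝ → ℝ) : Prop :=
  (∀ r ε : ℝ, 0 < r → ε ∈ Set.Ioc (0:ℝ) 2 → η r ε ∈ Set.Ioc (0:ℝ) 1) ∧
  (∀ r ε : ℝ, ∀ a x y : X, 0 < r → ε ∈ Set.Ioc (0:ℝ) 2 →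
    dist x a ≤ r → dist y a ≤ r → ε * r ≤ dist x y →
    dist (W x y (1/2)) a ≤ (1 - η r ε) * r)

/-- The modulus `η` is monotone: nonincreasing in `r` for each fixed `ε`. -/
def MonotoneUCModulus (η : ℝ → ℝ → ℝ) : Prop :=
  ∀ ε ∈ Set.Ioc (0:ℝ) 2, ∀ r s : ℝ, 0 < r → r ≤ s → η s ε ≤ η r ε

/-- `C` is a convex subset w.r.t. the convexity map `W`. -/
def WConvex [MetricSpace X] (W : X → X → ℝ → X) (C : Set X) : Prop :=
  ∀ x ∈ C, ∀ y ∈ C, ∀ t ∈ Set.Icc (0:ℝ) 1, W x y t ∈ C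

/-- `T : C → C` is asymptotically nonexpansive with sequence `k`. -/
def AsymptoticallyNonexpansive [MetricSpace X] (C : Set X) (T : X → X) (k : ℕ → ℝ) : Prop :=
  Set.MapsTo T C C ∧ (∀ n, 0 ≤ k n) ∧
  Filter.Tendsto k Filter.atTop (nhds 0) ∧
  ∀ n : ℕ, ∀ x ∈ C, ∀ y ∈ C, dist (T^[n] x) (T^[n] y) ≤ (1 + k n) * dist x y

/-- `xseq` is the Krasnoselski–Mann iteration of `T` starting from `x`:
`x₀ = x`, `x_{n+1} = (1-λ_n) x_n ⊕ λ_n T^n x_n`. -/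
def IsKMIteration [MetricSpace X] (W : X → X → ℝ → X) (T : X → X) (lam : ℕ → ℝ)
    (x : X) (xseq : ℕ → X) : Prop :=
  xseq 0 = x ∧ ∀ n, xseq (n + 1) = W (xseq n) (T^[n] (xseq n)) (lam n)

end Hyperbolic

/-- In a uniformly convex hyperbolic space, a point dividing the segment from `x` to `y` in a given
ratio is unique. -/
theorem IsWMap.eq_of_dist_le {X : Type*} [MetricSpace X] {W : X → X → ℝ → X} {η : ℝ → ℝ → ℝ}
    (hW : IsWMap W) (hUC : IsUCModulus W η) {x y z w : X} {t : ℝ}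
    (hzx : dist z x ≤ t * dist x y) (hwx : dist w x ≤ t * dist x y)
    (hzy : dist y z ≤ (1 - t) * dist x y) (hwy : dist y w ≤ (1 - t) * dist x y) : z = w := by
  have hhalf : (1 / 2 : ℝ) ∈ Set.Icc (0 : ℝ) 1 := by norm_num
  by_contra hne
  have hzw : 0 < dist z w := dist_pos.2 hne
  set r := t * dist x y with hr
  have htri : dist z w ≤ 2 * r := by linarith [dist_triangle_right z w x]
  have hr0 : 0 < r := by linarith
  have hmem : dist z w / r ∈ Set.Ioc (0 : ℝ) 2 := ⟨div_pos hzw hr0, (div_le_iff₀ hr0).2 htri⟩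
  have hη := (hUC.1 r _ hr0 hmem).1
  have hx := hUC.2 r _ x z w hr0 hmem hzx hwx (div_mul_cancel₀ _ hr0.ne').le
  have hy := hW.w1 z w y _ hhalf
  have := dist_triangle_right x y (W z w (1 / 2))
  rw [dist_comm x (W _ _ _)] at this
  nlinarith [mul_pos hη hr0]

/-- Uniform convexity estimate for arbitrary convex combinations. -/
theorem IsWMap.dist_le_of_isUCModulus {X : Type*} [MetricSpace X] {W : X → X → ℝ → X}
    {η : ℝ → ℝ → ℝ} (hW : IsWMap W) (hUC : IsUCModulus W η) {r ε t : ℝ} {a x y : X} (hr : 0 < r)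
    (hε : ε ∈ Set.Ioc (0 : ℝ) 2) (hx : dist x a ≤ r) (hy : dist y a ≤ r) (hxy : ε * r ≤ dist x y)
    (ht : t ∈ Set.Icc (0 : ℝ) 1) : dist (W x y t) a ≤ (1 - 2 * t * (1 - t) * η r ε) * r := by
  wlog ht2 : t ≤ 1 / 2 generalizing x y t
  · have h1 := this hy hx (dist_comm x y ▸ hxy) (t := 1 - t)
      ⟨by linarith [ht.2], by linarith [ht.1]⟩ (by linarith)
    rw [hW.w3 x y t ht]
    exact h1.trans_eq (by ring)
  have hhalf : (1 / 2 : ℝ) ∈ Set.Icc (0 : ℝ) 1 := by norm_num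
  have ht' : 2 * t ∈ Set.Icc (0 : ℝ) 1 := ⟨by linarith [ht.1], by linarith⟩
  have hη := (hUC.1 r ε hr hε).1
  have hmid := hUC.2 r ε a x y hr hε hx hy hxy
  set m := W x y (1 / 2) with hm
  have hmx : dist x m ≤ 1 / 2 * dist x y := by
    have := hW.w1 x y x _ hhalf
    rw [dist_self] at this
    linarith
  have hmy : dist y m ≤ 1 / 2 * dist x y := by
    have := hW.w1 x y y _ hhalf
    rw [dist_self, dist_comm y x] at this
    linarith
  have heq : W x y t = W x m (2 * t) := by
    apply hW.eq_of_dist_le hUC (x := x) (y := y) (t := t)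
    · have := hW.w1 x y x t ht
      rw [dist_self, dist_comm] at this
      linarith
    · have := hW.w1 x m x _ ht'
      rw [dist_self, dist_comm] at this
      nlinarith [ht.1]
    · have := hW.w1 x y y t ht
      rw [dist_self, dist_comm y x] at this
      linarith
    · have := hW.w1 x m y _ ht'
      rw [dist_comm y x] at this
      nlinarith [ht.1]
  have h1 := hW.w1 x m a _ ht'
  rw [heq, dist_comm]
  rw [dist_comm a x, dist_comm a m] at h1
  have h2 : 2 * t * dist m a ≤ 2 * t * ((1 - η r ε) * r) := mul_le_mul_of_nonneg_left hmid ht'.1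
  have h3 : (1 - 2 * t) * dist x a ≤ (1 - 2 * t) * r :=
    mul_le_mul_of_nonneg_left hx (by linarith)
  have h4 : 0 ≤ t * t * (η r ε * r) := mul_nonneg (mul_self_nonneg t) (mul_pos hη hr).le
  nlinarith

/-- An almost fixed point of `T` is almost fixed by the iterates of `T`. -/
theorem AsymptoticallyNonexpansive.dist_iterate_le {X : Type*} [MetricSpace X] {C : Set X}
    {T : X → X} {k : ℕ → ℝ} (hT : AsymptoticallyNonexpansive C T k) {p : X} (hp : p ∈ C) (n : ℕ) :
    dist (T^[n] p) p ≤ (n + ∑ i ∈ Finset.range n, k i) * dist (T p) p := by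
  induction n with
  | zero => simp
  | succ n ih =>
    have h1 := hT.2.2.2 n (T p) (hT.1 hp) p hp
    have h2 := dist_triangle (T^[n] (T p)) (T^[n] p) p
    rw [Function.iterate_succ_apply, Finset.sum_range_succ]
    push_cast
    linarith

/-- A discrete Gronwall inequality with constant error term. -/
theorem le_exp_sum_mul_of_le_one_add_mul {a k : ℕ → ℝ} {τ : ℝ} {P : ℕ} (hτ : 0 ≤ τ)
    (hk : ∀ n, 0 ≤ k n) (ha : ∀ n, 0 ≤ a n) (hstep : ∀ n < P, a (n + 1) ≤ (1 + k n) * a n + τ)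
    {n : ℕ} (hn : n ≤ P) : a n ≤ Real.exp (∑ i ∈ Finset.range n, k i) * (a 0 + n * τ) := by
  induction n with
  | zero => simp
  | succ n ih =>
    have ih := ih (by omega)
    have h1 := hstep n (by omega)
    have h2 : 1 + k n ≤ Real.exp (k n) := by linarith [Real.add_one_le_exp (k n)]
    have h3 : 1 ≤ Real.exp (∑ i ∈ Finset.range (n + 1), k i) :=
      Real.one_le_exp (Finset.sum_nonneg fun i _ => hk i)
    have h4 := mul_le_mul h2 ih (ha n) (Real.exp_pos _).le
    rw [← mul_assoc, ← Real.exp_add, add_comm (k n), ← Finset.sum_range_succ] at h4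
    push_cast
    nlinarith

/-- If a sequence is nonincreasing and drops by `s` somewhere in each interval
`[h^i 0, h^(i+1) 0)`, then it has dropped by `M * s` at `h^M 0`. -/
theorem iterate_le_sub_of_drop {u : ℕ → ℝ} {h : ℕ → ℕ} {s : ℝ} {P M : ℕ} (hh : ∀ n, n < h n)
    (hP : h^[M] 0 ≤ P) (hu : ∀ n < P, u (n + 1) ≤ u n)
    (hdrop : ∀ i < M, ∃ n, h^[i] 0 ≤ n ∧ n < h (h^[i] 0) ∧ u (n + 1) ≤ u n - s) :
    u (h^[M] 0) ≤ u 0 - M * s := by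
  have hmono : ∀ m n, m ≤ n → n ≤ P → u n ≤ u m := by
    intro m n hmn
    induction n, hmn using Nat.le_induction with
    | base => intro _; rfl
    | succ n _ ih => intro hn; exact (hu n (by omega)).trans (ih (by omega))
  induction M with
  | zero => simp
  | succ M ih =>
    rw [Function.iterate_succ_apply'] at hP ⊢
    have h0 := hh (h^[M] 0)
    have ih := ih (by omega) fun i hi => hdrop i (by omega)
    obtain ⟨n, hn1, hn2, hn3⟩ := hdrop M (by omega)
    have h1 := hmono _ n hn1 (by omega)
    have h2 := hmono (n + 1) _ hn2 hP
    push_cast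
    linarith

/-- Along the Krasnoselski–Mann iteration, `d(x_{n+1}, T x_{n+1})` is controlled by the
displacements `d(x_n, T^n x_n)` and `d(x_{n+1}, T^{n+1} x_{n+1})`. -/
theorem IsKMIteration.dist_map_succ_le {X : Type*} [MetricSpace X] {W : X → X → ℝ → X}
    (hW : IsWMap W) {C : Set X} {T : X → X} {k : ℕ → ℝ} (hT : AsymptoticallyNonexpansive C T k)
    {lam : ℕ → ℝ} {x : X} {xseq : ℕ → X} (hKM : IsKMIteration W T lam x xseq)
    (hmem : ∀ n, xseq n ∈ C) {n : ℕ} (hlam : lam n ∈ Set.Icc (0 : ℝ) 1) :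
    dist (xseq (n + 1)) (T (xseq (n + 1))) ≤ dist (xseq (n + 1)) (T^[n + 1] (xseq (n + 1))) +
      (1 + k 1) * ((1 + k n) * dist (xseq n) (T^[n] (xseq n))) := by
  obtain ⟨hmap, hk, -, hlip⟩ := hT
  have hl := hlam.1
  have h1 : dist (xseq n) (xseq (n + 1)) ≤ lam n * dist (xseq n) (T^[n] (xseq n)) := by
    have := hW.w1 (xseq n) (T^[n] (xseq n)) (xseq n) _ hlam
    rw [← hKM.2 n, dist_self] at this
    linarith
  have h2 : dist (T^[n] (xseq n)) (xseq (n + 1)) ≤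
      (1 - lam n) * dist (xseq n) (T^[n] (xseq n)) := by
    have := hW.w1 (xseq n) (T^[n] (xseq n)) (T^[n] (xseq n)) _ hlam
    rw [← hKM.2 n, dist_self, dist_comm _ (xseq n)] at this
    linarith
  have h3 : dist (T^[n] (xseq (n + 1))) (xseq (n + 1)) ≤
      (1 + k n) * dist (xseq n) (T^[n] (xseq n)) := by
    have h4 := hlip n _ (hmem n) _ (hmem (n + 1))
    have h5 := dist_triangle_left (T^[n] (xseq (n + 1))) (xseq (n + 1)) (T^[n] (xseq n))
    have h6 := mul_le_mul_of_nonneg_left h1 (add_nonneg zero_le_one (hk n))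
    have h7 : 0 ≤ k n * ((1 - lam n) * dist (xseq n) (T^[n] (xseq n))) :=
      mul_nonneg (hk n) (mul_nonneg (by linarith [hlam.2]) dist_nonneg)
    linarith
  have h8 := hlip 1 _ (hmap.iterate n (hmem (n + 1))) _ (hmem (n + 1))
  rw [Function.iterate_one, ← Function.iterate_succ_apply' T] at h8
  have h9 := mul_le_mul_of_nonneg_left h3 (add_nonneg zero_le_one (hk 1))
  linarith [dist_triangle (xseq (n + 1)) (T^[n + 1] (xseq (n + 1))) (T (xseq (n + 1)))]

/-- metastability as in Theorem 3.5, with the bound using `η̃` when the modulus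
decomposes as `η(r,ε) = ε·η̃(r,ε)` with `η̃` nondecreasing in `ε`. -/
theorem metastability_KM_asymptotically_nonexpansive_etaTilde
    {X : Type*} [MetricSpace X]
    (W : X → X → ℝ → X) (η ηt : ℝ → ℝ → ℝ)
    (hW : IsWMap W) (hUC : IsUCModulus W η) (hMon : MonotoneUCModulus η)
    (hdecomp : ∀ r : ℝ, 0 < r → ∀ ε ∈ Set.Ioc (0:ℝ) 2, η r ε = ε * ηt r ε)
    (hηtmono : ∀ r : ℝ, ∀ ε₁ ε₂ : ℝ, 0 < ε₁ → ε₁ ≤ ε₂ → ε₂ ≤ 2 → ηt r ε₁ ≤ ηt r ε₂)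
    (C : Set X) (hne : C.Nonempty) (hconv : WConvex W C)
    (T : X → X) (k : ℕ → ℝ) (hT : AsymptoticallyNonexpansive C T k)
    (K : ℝ) (hK : 0 ≤ K) (hsum : ∀ n : ℕ, ∑ i ∈ Finset.range n, k i ≤ K)
    (L : ℕ) (hL : 2 ≤ L) (lam : ℕ → ℝ)
    (hlam : ∀ n, 1 / (L : ℝ) ≤ lam n ∧ lam n ≤ 1 - 1 / (L : ℝ))
    (x : X) (hx : x ∈ C) (b : ℝ) (hb : 0 < b)
    (happ : ∀ δ > (0:ℝ), ∃ p ∈ C, dist x p ≤ b ∧ dist (T p) p ≤ δ)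
    (xseq : ℕ → X) (hKM : IsKMIteration W T lam x xseq)
    (ε : ℝ) (hε : 0 < ε) (hε1 : ε ≤ 1) (g : ℕ → ℕ)
    (fK D θ : ℝ) (h : ℕ → ℕ) (M Φ : ℕ)
    (hfK : fK = 2 * (1 + (1 + K) ^ 2 * (2 + K)))
    (hD : D = Real.exp K * (b + 2))
    (hθ : θ = ε / ((L : ℝ) ^ 2 * fK) * ηt ((1 + K) * D + 1) (ε / (fK * ((1 + K) * D + 1))))
    (hh : ∀ n, h n = g (n + 1) + n + 2)
    (hM : M = ⌈3 * (5 * K * D + D + 11 / 2) / θ⌉₊)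
    (hΦ : Φ = h^[M] 0) :
    ∃ N ≤ Φ, ∀ m, N ≤ m → m ≤ N + g N → dist (xseq m) (T (xseq m)) < ε := by
  have hkK : ∀ n, k n ≤ K := fun n =>
    (Finset.single_le_sum (fun i _ => hT.2.1 i) (Finset.self_mem_range_succ n)).trans
      (hsum (n + 1))
  have hL0 : (0 : ℝ) < L := by exact_mod_cast (by omega : 0 < L)
  have hL1 : 0 < 1 / (L : ℝ) := by positivity
  have hl01 : ∀ n, lam n ∈ Set.Icc (0 : ℝ) 1 := fun n =>
    ⟨by linarith [(hlam n).1], by linarith [(hlam n).2]⟩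
  have hmem : ∀ n, xseq n ∈ C := by
    intro n
    induction n with
    | zero => rw [hKM.1]; exact hx
    | succ n ih =>
      rw [hKM.2]
      exact hconv _ ih _ (hT.1.iterate n ih) _ (hl01 n)
  have hfK1 : 1 + (1 + K) ^ 2 ≤ fK := by
    rw [hfK]
    nlinarith [sq_nonneg (1 + K)]
  have hfK2 : 1 ≤ fK := by nlinarith [sq_nonneg (1 + K)]
  have hfK0 : 0 < fK := by linarith
  have hexp : 1 ≤ Real.exp K := Real.one_le_exp hK
  have hD0 : b + 2 ≤ D := by rw [hD]; nlinarith
  set R := (1 + K) * D + 1 with hR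
  have hR1 : 1 ≤ R := by rw [hR]; nlinarith
  have hR0 : 0 < R := by linarith
  set e := ε / fK with he
  have he0 : 0 < e := div_pos hε hfK0
  have he1 : e ≤ 1 := (div_le_one hfK0).2 (by linarith)
  have heR : ε / (fK * R) = e / R := by rw [he, div_div]
  have heR2 : e / R ∈ Set.Ioc (0 : ℝ) 2 :=
    ⟨div_pos he0 hR0, (div_le_iff₀ hR0).2 (by linarith)⟩
  rw [heR] at hθ
  have hηt0 : 0 < ηt R (e / R) := by
    have h1 := (hUC.1 R _ hR0 heR2).1
    rw [hdecomp R hR0 _ heR2] at h1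
    exact pos_of_mul_pos_right h1 heR2.1.le
  have hθe : θ = (1 / L) * (1 / L) * (e * ηt R (e / R)) := by
    rw [hθ, he]; field_simp
  have hθ0 : 0 < θ := by rw [hθe]; positivity
  have hMθ : 3 * (5 * K * D + D + 11 / 2) ≤ M * θ :=
    (div_le_iff₀ hθ0).1 (hM ▸ Nat.le_ceil _)
  set τ : ℝ := 1 / (Φ + 1) with hτ
  have hτ0 : 0 < τ := by positivity
  have hΦτ : Φ * τ + τ = 1 := by rw [hτ]; field_simp
  obtain ⟨p, hpC, hxp, hTp⟩ := happ (τ / (Φ + K + 1)) (by positivity)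
  have hTn : ∀ n ≤ Φ, dist (T^[n] p) p ≤ τ := by
    intro n hn
    have hn' : (n : ℝ) ≤ Φ := by exact_mod_cast hn
    have h1 : (n + ∑ i ∈ Finset.range n, k i) * dist (T p) p ≤
        (Φ + K + 1) * (τ / (Φ + K + 1)) :=
      mul_le_mul (by linarith [hsum n]) hTp dist_nonneg (by positivity)
    rw [mul_div_cancel₀ _ (by positivity)] at h1
    exact (hT.dist_iterate_le hpC n).trans h1
  have hTx : ∀ n ≤ Φ, dist (T^[n] (xseq n)) p ≤ (1 + k n) * dist (xseq n) p + τ := by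
    intro n hn
    linarith [hT.2.2.2 n _ (hmem n) p hpC, hTn n hn, dist_triangle (T^[n] (xseq n)) (T^[n] p) p]
  have hx_le : ∀ n, dist (xseq n) p ≤ (1 + k n) * dist (xseq n) p + τ := fun n => by
    nlinarith [mul_nonneg (hT.2.1 n) (dist_nonneg (x := xseq n) (y := p))]
  have hstep : ∀ n < Φ, dist (xseq (n + 1)) p ≤ (1 + k n) * dist (xseq n) p + τ := by
    intro n hn
    have h1 := hW.w1 (xseq n) (T^[n] (xseq n)) p _ (hl01 n)
    rw [← hKM.2 n, dist_comm, dist_comm p, dist_comm p] at h1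
    have h2 := mul_le_mul_of_nonneg_left (hx_le n) (sub_nonneg.2 (hl01 n).2)
    have h3 := mul_le_mul_of_nonneg_left (hTx n hn.le) (hl01 n).1
    linarith
  have hbound : ∀ n ≤ Φ, dist (xseq n) p ≤ D := by
    intro n hn
    have hn' : (n : ℝ) ≤ Φ := by exact_mod_cast hn
    have h1 := le_exp_sum_mul_of_le_one_add_mul hτ0.le hT.2.1
      (fun n => dist_nonneg (x := xseq n) (y := p)) hstep hn
    rw [hD]
    refine h1.trans (mul_le_mul (Real.exp_le_exp.2 (hsum n)) ?_ (by positivity)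
      (Real.exp_pos _).le)
    rw [hKM.1]
    nlinarith
  have hbad : ∀ n < Φ, e ≤ dist (xseq n) (T^[n] (xseq n)) →
      dist (xseq (n + 1)) p ≤ (1 + k n) * dist (xseq n) p + τ - 2 * θ := by
    intro n hn hen
    set r := (1 + k n) * dist (xseq n) p + τ with hr
    have hr0 : 0 < r := by have := hT.2.1 n; positivity
    have hrR : r ≤ R := by
      have := mul_le_mul (add_le_add_right (hkK n) 1) (hbound n hn.le) dist_nonneg (by linarith)
      have : 0 ≤ Φ * τ := by positivity
      linarith
    have her : e / r ∈ Set.Ioc (0 : ℝ) 2 := by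
      refine ⟨div_pos he0 hr0, (div_le_iff₀ hr0).2 ?_⟩
      linarith [dist_triangle_right (xseq n) (T^[n] (xseq n)) p, hx_le n, hTx n hn.le]
    have h1 := hW.dist_le_of_isUCModulus hUC hr0 her (hx_le n) (hTx n hn.le)
      ((div_mul_cancel₀ _ hr0.ne').le.trans hen) (hl01 n)
    rw [← hKM.2 n] at h1
    have h2 : e * ηt R (e / R) ≤ η r (e / r) * r := by
      have h3 := hMon _ her r R hr0 hrR
      rw [hdecomp R hR0 _ her] at h3
      have h4 := hηtmono R (e / R) (e / r) heR2.1 (by gcongr) her.2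
      calc e * ηt R (e / R) ≤ e * ηt R (e / r) := by gcongr
        _ = e / r * ηt R (e / r) * r := by field_simp
        _ ≤ _ := by gcongr
    have h5 : 1 / (L : ℝ) * (1 / L) ≤ lam n * (1 - lam n) :=
      mul_le_mul (hlam n).1 (by linarith [(hlam n).2]) hL1.le (hl01 n).1
    have h6 := mul_le_mul h5 h2 (by positivity) ((by positivity : (0 : ℝ) ≤ _).trans h5)
    rw [← hθe] at h6
    linarith
  have hlt : ∀ n, n < h n := fun n => by rw [hh]; omega
  have hh_mono : Monotone fun i => h^[i] 0 := monotone_nat_of_le_succ fun i => by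
    rw [Function.iterate_succ_apply']
    exact (hlt _).le
  obtain ⟨i, hi, hgood⟩ : ∃ i < M, ∀ n, h^[i] 0 ≤ n → n < h (h^[i] 0) →
      dist (xseq n) (T^[n] (xseq n)) < e := by
    by_contra! hcon
    have hkD : ∀ n ≤ Φ, k n * dist (xseq n) p ≤ k n * D := fun n hn =>
      mul_le_mul_of_nonneg_left (hbound n hn) (hT.2.1 n)
    have key := iterate_le_sub_of_drop (s := 2 * θ) (P := Φ) (M := M)
      (u := fun n => dist (xseq n) p - (∑ j ∈ Finset.range n, k j) * D - n * τ) hlt hΦ.ge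
      (fun n hn => by
        simp only [Finset.sum_range_succ]
        push_cast
        linarith [hstep n hn, hkD n hn.le])
      (fun i hi => by
        obtain ⟨n, hn1, hn2, hn3⟩ := hcon i hi
        have hn : n < Φ := by
          have := hh_mono (Nat.succ_le_of_lt hi)
          simp only [Nat.succ_eq_add_one, Function.iterate_succ_apply'] at this
          omega
        refine ⟨n, hn1, hn2, ?_⟩
        simp only [Finset.sum_range_succ]
        push_cast
        linarith [hbad n hn hn3, hkD n hn.le])
    rw [← hΦ] at key
    simp only [Finset.range_zero, Finset.sum_empty, Nat.cast_zero, hKM.1] at key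
    have h1 := mul_le_mul_of_nonneg_right (hsum Φ) (by linarith : 0 ≤ D)
    have h2 : 0 ≤ K * D := mul_nonneg hK (by linarith)
    linarith [dist_nonneg (x := xseq Φ) (y := p)]
  refine ⟨h^[i] 0 + 1, ?_, ?_⟩
  · have := hh_mono (Nat.succ_le_of_lt hi)
    simp only [Nat.succ_eq_add_one, Function.iterate_succ_apply'] at this
    have := hlt (h^[i] 0)
    omega
  · intro m hm1 hm2
    obtain ⟨n, rfl⟩ : ∃ n, m = n + 1 := ⟨m - 1, by omega⟩
    have hhi := hh (h^[i] 0)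
    have h1 := hgood n (by omega) (by omega)
    have h2 := hgood (n + 1) (by omega) (by omega)
    have h3 := IsKMIteration.dist_map_succ_le hW hT hKM hmem (hl01 n)
    have h4 : (1 + k 1) * ((1 + k n) * dist (xseq n) (T^[n] (xseq n))) ≤
        (1 + K) * ((1 + K) * e) := by
      have := hkK 1
      have := hkK n
      have := hT.2.1 1
      have := hT.2.1 n
      gcongr
    have h5 : (1 + (1 + K) ^ 2) * e ≤ fK * e := mul_le_mul_of_nonneg_right hfK1 he0.le
    have h6 : fK * e = ε := mul_div_cancel₀ _ hfK0.ne'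
    linarith
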